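/- arXiv:2207.10371 — 7 statements merged into one kernel-verified Lean document; each statement's English description precedes it below -/
import Mathlib

section
/- For all real constants C1 > 0, C2 > 0 and C3 > 0, the function φ(x, y) = Real.log (C1·C2/(x·y) + C3/x) is convex on the open positive quadrant {(x, y) ∈ ℝ × ℝ : x > 0 and y > 0}. -/
theorem convexOn_log_div_add_const {A B : ℝ} (hA : 0 < A) (hB : 0 < B) :
    ConvexOn ℝ (Set.Ioi 0) (fun y : ℝ => Real.log (A / y + B)) := by
  have hderiv : ∀ y ∈ Set.Ioi (0 : ℝ),
      HasDerivAt (fun y : ℝ => Real.log (A / y + B)) (-(A / (y * (A + B * y)))) y := by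
    intro y hy
    have hy : 0 < y := hy
    have hpos : 0 < A / y + B := by positivity
    convert (((hasDerivAt_inv hy.ne').const_mul A).add_const B).log hpos.ne' using 1 <;> field_simp
  refine MonotoneOn.convexOn_of_deriv (convex_Ioi 0)
    (fun y hy => (hderiv y hy).continuousAt.continuousWithinAt) ?_ ?_ <;> rw [interior_Ioi]
  · exact fun y hy => (hderiv y hy).differentiableAt.differentiableWithinAt
  · intro y hy z hz hyz
    rw [(hderiv y hy).deriv, (hderiv z hz).deriv]
    have hy : 0 < y := hy
    have hz : 0 < z := hz
    gcongr

/-- For all real constants `C1 > 0`, `C2 > 0`, `C3 > 0`, the function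
`φ(x, y) = log (C1·C2/(x·y) + C3/x)` is convex on the open positive quadrant. -/
theorem stmt_0 (C1 C2 C3 : ℝ) (hC1 : 0 < C1) (hC2 : 0 < C2) (hC3 : 0 < C3) :
    ConvexOn ℝ {p : ℝ × ℝ | 0 < p.1 ∧ 0 < p.2}
      (fun p : ℝ × ℝ => Real.log (C1 * C2 / (p.1 * p.2) + C3 / p.1)) := by
  have hquadrant : Convex ℝ {p : ℝ × ℝ | 0 < p.1 ∧ 0 < p.2} :=
    (convex_Ioi (0 : ℝ)).prod (convex_Ioi (0 : ℝ))
  have hx : ConvexOn ℝ {p : ℝ × ℝ | 0 < p.1 ∧ 0 < p.2} (fun p => -Real.log p.1) :=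
    (strictConcaveOn_log_Ioi.concaveOn.neg.comp_linearMap (LinearMap.fst ℝ ℝ ℝ)).subset
      (fun _ hp => hp.1) hquadrant
  have hy : ConvexOn ℝ {p : ℝ × ℝ | 0 < p.1 ∧ 0 < p.2}
      (fun p => Real.log (C1 * C2 / p.2 + C3)) :=
    ((convexOn_log_div_add_const (mul_pos hC1 hC2) hC3).comp_linearMap
      (LinearMap.snd ℝ ℝ ℝ)).subset (fun _ hp => hp.2) hquadrant
  refine (hx.add hy).congr fun p ⟨hp1, hp2⟩ => ?_
  have hpos : 0 < C1 * C2 / p.2 + C3 := by positivity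
  have hfactor : C1 * C2 / (p.1 * p.2) + C3 / p.1 = p.1⁻¹ * (C1 * C2 / p.2 + C3) := by
    field_simp
  simp only [Pi.add_apply]
  rw [hfactor, Real.log_mul (inv_ne_zero hp1.ne') hpos.ne', Real.log_inv]
end

section
/- Fix K ≥ 1, positive real constants C1, C2, C3, nonnegative weights P_1, …, P_K, and σ² > 0. The function F : ℝ^K × ℝ^K → ℝ given by F(x, y) = logb 2 ( Σ_{i=1}^{K} P_i · ( C1·C2/(x_i · y_i) + C3/x_i ) + σ² ) is convex on the set {(x, y) : x_i > 0 and y_i > 0 for every i = 1, …, K}. -/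
/-- If `z` dominates the weighted geometric mean of `w` and `w'`, then `z⁻¹` is bounded by a
normalized weighted arithmetic mean of `w⁻¹` and `w'⁻¹`. -/
theorem inv_le_rpow_mul_rpow_mul_add {a b w w' z S T : ℝ} (ha : 0 ≤ a) (hb : 0 ≤ b)
    (hab : a + b = 1) (hw : 0 < w) (hw' : 0 < w') (hS : 0 < S) (hT : 0 < T)
    (hz : w ^ a * w' ^ b ≤ z) :
    z⁻¹ ≤ S ^ a * T ^ b * (a * (w⁻¹ / S) + b * (w'⁻¹ / T)) := by
  have hpos : 0 < w ^ a * w' ^ b := by positivity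
  calc z⁻¹ ≤ (w ^ a * w' ^ b)⁻¹ := inv_anti₀ hpos hz
    _ = S ^ a * T ^ b * ((w⁻¹ / S) ^ a * (w'⁻¹ / T) ^ b) := by
      rw [Real.div_rpow (by positivity) hS.le, Real.div_rpow (by positivity) hT.le,
        Real.inv_rpow hw.le, Real.inv_rpow hw'.le]
      have := (Real.rpow_pos_of_pos hS a).ne'
      have := (Real.rpow_pos_of_pos hT b).ne'
      field_simp
    _ ≤ _ := by
      gcongr
      exact Real.geom_mean_le_arith_mean2_weighted ha hb (by positivity) (by positivity) hab

/-- Lemma 1: `F(x, y) = log₂ ( Σ_i P_i (C1 C2/(x_i y_i) + C3/x_i) + σ² )` is convex on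
the set where all coordinates of `x` and `y` are positive. -/
theorem stmt_1 (K : ℕ) (hK : 1 ≤ K) (C1 C2 C3 : ℝ) (hC1 : 0 < C1) (hC2 : 0 < C2)
    (hC3 : 0 < C3) (P : Fin K → ℝ) (hP : ∀ i, 0 ≤ P i) (σ2 : ℝ) (hσ : 0 < σ2) :
    ConvexOn ℝ
      {p : (Fin K → ℝ) × (Fin K → ℝ) | (∀ i, 0 < p.1 i) ∧ (∀ i, 0 < p.2 i)}
      (fun p : (Fin K → ℝ) × (Fin K → ℝ) =>
        Real.logb 2 (∑ i, P i * (C1 * C2 / (p.1 i * p.2 i) + C3 / p.1 i) + σ2)) := by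
  have comb_pos : ∀ {a b u v : ℝ}, 0 ≤ a → 0 ≤ b → a + b = 1 → 0 < u → 0 < v →
      0 < a * u + b * v := fun {a b u v} ha hb hab hu hv =>
    (convex_Ioi (0 : ℝ)) hu hv ha hb hab
  refine ⟨?_, ?_⟩
  · rintro p ⟨hp1, hp2⟩ q ⟨hq1, hq2⟩ a b ha hb hab
    exact ⟨fun i => comb_pos ha hb hab (hp1 i) (hq1 i),
      fun i => comb_pos ha hb hab (hp2 i) (hq2 i)⟩
  rintro ⟨x, y⟩ ⟨hx, hy⟩ ⟨x', y'⟩ ⟨hx', hy'⟩ a b ha hb hab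
  simp only [Prod.smul_mk, Prod.mk_add_mk, Pi.add_apply, Pi.smul_apply, smul_eq_mul] at *
  have total_pos : ∀ u v : Fin K → ℝ, (∀ i, 0 < u i) → (∀ i, 0 < v i) →
      0 < ∑ i, P i * (C1 * C2 / (u i * v i) + C3 / u i) + σ2 := fun u v hu hv =>
    add_pos_of_nonneg_of_pos (Finset.sum_nonneg fun i _ => by
      have := hu i; have := hv i; have := hP i; positivity) hσ
  have hZ := total_pos (fun i => a * x i + b * x' i) (fun i => a * y i + b * y' i)
    (fun i => comb_pos ha hb hab (hx i) (hx' i)) (fun i => comb_pos ha hb hab (hy i) (hy' i))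
  have hS := total_pos x y hx hy
  have hT := total_pos x' y' hx' hy'
  set S := ∑ i, P i * (C1 * C2 / (x i * y i) + C3 / x i) + σ2 with hSdef
  set T := ∑ i, P i * (C1 * C2 / (x' i * y' i) + C3 / x' i) + σ2 with hTdef
  have hSa := Real.rpow_pos_of_pos hS a
  have hTb := Real.rpow_pos_of_pos hT b
  have amgm : ∀ {u v : ℝ}, 0 < u → 0 < v → u ^ a * v ^ b ≤ a * u + b * v := fun hu hv =>
    Real.geom_mean_le_arith_mean2_weighted ha hb hu.le hv.le hab
  have term_le : ∀ i, P i * (C1 * C2 / ((a * x i + b * x' i) * (a * y i + b * y' i)) +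
      C3 / (a * x i + b * x' i)) ≤
      S ^ a * T ^ b * (a / S * (P i * (C1 * C2 / (x i * y i) + C3 / x i)) +
        b / T * (P i * (C1 * C2 / (x' i * y' i) + C3 / x' i))) := by
    intro i
    have hxi := hx i
    have hyi := hy i
    have hxi' := hx' i
    have hyi' := hy' i
    have hxy : (x i * y i) ^ a * (x' i * y' i) ^ b ≤
        (a * x i + b * x' i) * (a * y i + b * y' i) := by
      rw [Real.mul_rpow hxi.le hyi.le, Real.mul_rpow hxi'.le hyi'.le, mul_mul_mul_comm]
      exact mul_le_mul (amgm hxi hxi') (amgm hyi hyi') (by positivity) (by positivity)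
    have h₁ := inv_le_rpow_mul_rpow_mul_add ha hb hab (mul_pos hxi hyi) (mul_pos hxi' hyi')
      hS hT hxy
    have h₂ := inv_le_rpow_mul_rpow_mul_add ha hb hab hxi hxi' hS hT (amgm hxi hxi')
    have h₃ := mul_le_mul_of_nonneg_left (add_le_add
      (mul_le_mul_of_nonneg_left h₁ (mul_pos hC1 hC2).le)
      (mul_le_mul_of_nonneg_left h₂ hC3.le)) (hP i)
    simp only [div_eq_mul_inv] at h₃ ⊢
    exact h₃.trans_eq (by ring)
  have noise_le : σ2 ≤ S ^ a * T ^ b * (a / S * σ2 + b / T * σ2) := by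
    have h := inv_le_rpow_mul_rpow_mul_add (z := σ2⁻¹) ha hb hab (inv_pos.2 hσ) (inv_pos.2 hσ)
      hS hT (by rw [← Real.rpow_add (inv_pos.2 hσ), hab, Real.rpow_one])
    simp only [inv_inv] at h
    exact h.trans_eq (by ring)
  have total_le := add_le_add (Finset.sum_le_sum fun i (_ : i ∈ Finset.univ) => term_le i) noise_le
  rw [← Finset.mul_sum, Finset.sum_add_distrib, ← Finset.mul_sum, ← Finset.mul_sum, ← mul_add,
    add_add_add_comm, ← mul_add, ← mul_add, ← hSdef, ← hTdef, div_mul_cancel₀ _ hS.ne',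
    div_mul_cancel₀ _ hT.ne', hab, mul_one] at total_le
  calc _ ≤ Real.logb 2 (S ^ a * T ^ b) := Real.logb_le_logb_of_le one_lt_two hZ total_le
    _ = a * Real.logb 2 S + b * Real.logb 2 T := by
      rw [Real.logb_mul hSa.ne' hTb.ne', Real.logb_rpow_eq_mul_logb_of_pos hS,
        Real.logb_rpow_eq_mul_logb_of_pos hT]
end

section
/- Fix K ≥ 1, positive real constants C1, C2, C3, nonnegative weights P_1, …, P_K, σ² > 0, and reference points X_1^r, …, X_K^r > 0 and Y_1^r, …, Y_K^r > 0. Define D = (Real.log 2) · ( Σ_{j=1}^{K} P_j · ( (C1·C2/Y_j^r + C3) / X_j^r ) + σ² ), O_i = − P_i · ( C1·C2 + C3·Y_i^r ) / ( (X_i^r)² · Y_i^r · D ), and G_i = − P_i · C1·C2 / ( X_i^r · (Y_i^r)² · D ). Then for all X_1, …, X_K > 0 and Y_1, …, Y_K > 0: logb 2 ( Σ_{i=1}^{K} P_i·( C1·C2/(X_i·Y_i) + C3/X_i ) + σ² ) ≥ logb 2 ( Σ_{i=1}^{K} P_i·( C1·C2/(X_i^r·Y_i^r) + C3/X_i^r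 ) + σ² ) + Σ_{i=1}^{K} O_i·(X_i − X_i^r) + Σ_{i=1}^{K} G_i·(Y_i − Y_i^r). -/
/-- Tangent-type bound for a posynomial term, in the variables `x / xr` and `y / yr`. -/
lemma exp_mul_le_div_mul_add_div {a c p x y xr yr : ℝ} (ha : 0 ≤ a) (hc : 0 ≤ c) (hp : 0 ≤ p)
    (hx : 0 < x) (hy : 0 < y) (hxr : 0 < xr) (hyr : 0 < yr) (T : ℝ) :
    Real.exp T * (p * (a / (xr * yr) + c / xr) * (1 - T)
        - p * (a + c * yr) / (xr ^ 2 * yr) * (x - xr) - p * a / (xr * yr ^ 2) * (y - yr)) ≤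
      p * (a / (x * y) + c / x) := by
  have inv_bound : ∀ z : ℝ, 0 < z → Real.exp (1 - z) ≤ z⁻¹ := fun z hz => by
    have h : z ≤ Real.exp (z - 1) := by linarith [Real.add_one_le_exp (z - 1)]
    have h' := inv_anti₀ hz h
    rwa [← Real.exp_neg, neg_sub] at h'
  have exp_tangent : ∀ t : ℝ, Real.exp T * (1 + t - T) ≤ Real.exp t := fun t => by
    have h : 1 + t - T ≤ Real.exp (t - T) := by linarith [Real.add_one_le_exp (t - T)]
    calc Real.exp T * (1 + t - T) ≤ Real.exp T * Real.exp (t - T) := by gcongr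
      _ = Real.exp t := by rw [← Real.exp_add, add_sub_cancel]
  have hX := inv_bound (x / xr) (by positivity)
  have hY := inv_bound (y / yr) (by positivity)
  have h1 := (exp_tangent (1 - x / xr)).trans hX
  have h2 : Real.exp T * (1 + ((1 - x / xr) + (1 - y / yr)) - T) ≤ (x / xr)⁻¹ * (y / yr)⁻¹ := by
    refine (exp_tangent _).trans ?_
    rw [Real.exp_add]
    gcongr
  have h3 := add_le_add
    (mul_le_mul_of_nonneg_left h2 (show 0 ≤ p * (a / (xr * yr)) by positivity))
    (mul_le_mul_of_nonneg_left h1 (show 0 ≤ p * (c / xr) by positivity))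
  refine (le_of_eq ?_).trans (h3.trans_eq ?_)
  · field_simp
    ring
  · field_simp

/-- Theorem 1: the first-order Taylor expansion of
`log₂ ( Σ_i P_i (C1 C2/(X_i Y_i) + C3/X_i) + σ² )` at the reference point
`(Xʳ, Yʳ)` is a global lower bound, with the explicit partial derivatives `O_i`, `G_i`. -/
theorem stmt_3 (K : ℕ) (hK : 1 ≤ K) (C1 C2 C3 : ℝ) (hC1 : 0 < C1) (hC2 : 0 < C2)
    (hC3 : 0 < C3) (P : Fin K → ℝ) (hP : ∀ i, 0 ≤ P i) (σ2 : ℝ) (hσ : 0 < σ2)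
    (Xr Yr : Fin K → ℝ) (hXr : ∀ i, 0 < Xr i) (hYr : ∀ i, 0 < Yr i)
    (D : ℝ) (hD : D = Real.log 2 * (∑ j, P j * ((C1 * C2 / Yr j + C3) / Xr j) + σ2))
    (O G : Fin K → ℝ)
    (hO : ∀ i, O i = -(P i * (C1 * C2 + C3 * Yr i)) / ((Xr i) ^ 2 * Yr i * D))
    (hG : ∀ i, G i = -(P i * (C1 * C2)) / (Xr i * (Yr i) ^ 2 * D)) :
    ∀ X Y : Fin K → ℝ, (∀ i, 0 < X i) → (∀ i, 0 < Y i) →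
      Real.logb 2 (∑ i, P i * (C1 * C2 / (X i * Y i) + C3 / X i) + σ2) ≥
        Real.logb 2 (∑ i, P i * (C1 * C2 / (Xr i * Yr i) + C3 / Xr i) + σ2) +
          ∑ i, O i * (X i - Xr i) + ∑ i, G i * (Y i - Yr i) := by
  intro X Y hX hY
  have hlog2 : 0 < Real.log 2 := Real.log_pos one_lt_two
  set f : Fin K → ℝ := fun i => P i * (C1 * C2 / (Xr i * Yr i) + C3 / Xr i) with hf
  set l : Fin K → ℝ := fun i => P i * (C1 * C2 + C3 * Yr i) / (Xr i ^ 2 * Yr i) * (X i - Xr i)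
    + P i * (C1 * C2) / (Xr i * Yr i ^ 2) * (Y i - Yr i) with hl
  set S : ℝ := ∑ i, f i + σ2 with hS
  have hSpos : 0 < S := by
    have : 0 ≤ ∑ i, f i := Finset.sum_nonneg fun i _ => by
      have := hP i; have := hXr i; have := hYr i
      positivity
    positivity
  have hDS : D = Real.log 2 * S := by
    rw [hD, hS]
    congr 2
    refine Finset.sum_congr rfl fun j _ => ?_
    have := (hXr j).ne'; have := (hYr j).ne'
    simp only [hf]
    field_simp
  set T : ℝ := -(∑ i, l i) / S with hT
  have hTS : S * T = -∑ i, l i := by rw [hT]; field_simp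
  have hlin : ∑ i, O i * (X i - Xr i) + ∑ i, G i * (Y i - Yr i) = T / Real.log 2 := by
    rw [← Finset.sum_add_distrib, hT, ← Finset.sum_neg_distrib, div_div, Finset.sum_div]
    refine Finset.sum_congr rfl fun i _ => ?_
    have := (hXr i).ne'; have := (hYr i).ne'
    rw [hO, hG, hDS]
    simp only [hl]
    field_simp
    ring
  have hkey : Real.exp T * S ≤ ∑ i, P i * (C1 * C2 / (X i * Y i) + C3 / X i) + σ2 := by
    have hsum : ∑ i, Real.exp T * (f i * (1 - T) - l i) ≤
        ∑ i, P i * (C1 * C2 / (X i * Y i) + C3 / X i) :=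
      Finset.sum_le_sum fun i _ => by
        simpa only [hf, hl, sub_add_eq_sub_sub] using exp_mul_le_div_mul_add_div
          (mul_pos hC1 hC2).le hC3.le (hP i) (hX i) (hY i) (hXr i) (hYr i) T
    rw [← Finset.mul_sum, Finset.sum_sub_distrib, ← Finset.sum_mul] at hsum
    have hone : Real.exp T * (1 - T) ≤ 1 := by
      have h := Real.add_one_le_exp (-T)
      calc Real.exp T * (1 - T) ≤ Real.exp T * Real.exp (-T) := by gcongr; linarith
        _ = 1 := by rw [← Real.exp_add, add_neg_cancel, Real.exp_zero]
    have hnoise := mul_le_mul_of_nonneg_left hone hσ.le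
    calc Real.exp T * S
        = Real.exp T * ((∑ i, f i) * (1 - T) - ∑ i, l i) + σ2 * (Real.exp T * (1 - T)) := by
          linear_combination Real.exp T * hTS + Real.exp T * (1 - T) * hS
      _ ≤ _ := by linarith
  have hlog := Real.log_le_log (by positivity) hkey
  rw [Real.log_mul (Real.exp_pos T).ne' hSpos.ne', Real.log_exp] at hlog
  rw [ge_iff_le, add_assoc, hlin, Real.logb, Real.logb, ← add_div]
  gcongr
  linarith
end

section
/- For every real H > 0, the function u ↦ Real.arctan ( H / Real.sqrt u ) is convex on the open interval (0, ∞). -/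
theorem Real.hasDerivAt_arctan_div_sqrt (H : ℝ) {u : ℝ} (hu : 0 < u) :
    HasDerivAt (fun u => Real.arctan (H / √u)) (-(H / (2 * √u * (u + H ^ 2)))) u := by
  have hs : 0 < √u := Real.sqrt_pos.2 hu
  have hH : u + H ^ 2 ≠ 0 := by positivity
  have h := (((hasDerivAt_id u).sqrt hu.ne').fun_inv hs.ne').const_mul H |>.arctan
  simp only [id, ← div_eq_mul_inv] at h
  convert! h using 1
  rw [div_pow, Real.sq_sqrt hu.le]
  field_simp

/-- For every `H > 0`, the function `u ↦ arctan (H / √u)` is convex on `(0, ∞)`. -/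
theorem stmt_4 (H : ℝ) (hH : 0 < H) :
    ConvexOn ℝ (Set.Ioi (0 : ℝ)) (fun u => Real.arctan (H / Real.sqrt u)) := by
  have hd : ∀ u ∈ Set.Ioi (0 : ℝ), HasDerivAt (fun u => Real.arctan (H / √u))
      (-(H / (2 * √u * (u + H ^ 2)))) u :=
    fun _ hu => Real.hasDerivAt_arctan_div_sqrt H hu
  refine MonotoneOn.convexOn_of_deriv (convex_Ioi 0)
    (fun u hu => (hd u hu).continuousAt.continuousWithinAt) ?_ ?_ <;> rw [interior_Ioi]
  · exact fun u hu => (hd u hu).differentiableAt.differentiableWithinAt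
  · intro u hu v hv huv
    rw [(hd u hu).deriv, (hd v hv).deriv]
    have hu' : 0 < u := hu
    gcongr
end

section
/- Let H > 0, A ≥ 0, B ≥ 0 be real numbers, and let g, q, qʳ be points of the Euclidean plane ℝ² with q ≠ g and qʳ ≠ g. Set u₀ = ‖qʳ − g‖². Then 1 + A · Real.exp ( −B · ( (180/π) · Real.arctan ( H / ‖q − g‖ ) − A ) ) ≤ 1 + A · Real.exp ( −B · ( (180/π) · ( Real.arctan ( H / Real.sqrt u₀ ) − H · ( ‖q − g‖² − u₀ ) / ( 2 · Real.sqrt u₀ · (H² + u₀) ) ) − A ) ). -/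
open Real

lemma arctan_le_self_of_nonneg {y : ℝ} (hy : 0 ≤ y) : arctan y ≤ y := by
  have h := le_tan (arctan_nonneg.mpr hy) (arctan_lt_pi_div_two y)
  rwa [tan_arctan] at h

lemma div_one_add_sq_le_arctan {y : ℝ} (hy : 0 ≤ y) : y / (1 + y ^ 2) ≤ arctan y := by
  have h : sin (2 * arctan y) ≤ 2 * arctan y :=
    sin_le (mul_nonneg zero_le_two (arctan_nonneg.mpr hy))
  have hsc : sin (arctan y) * cos (arctan y) = y / (1 + y ^ 2) := by
    rw [sin_arctan, cos_arctan, div_mul_div_comm, mul_one, mul_self_sqrt (by positivity)]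
  rw [sin_two_mul, mul_assoc, hsc] at h
  linarith

lemma arctan_div_sub_arctan_div {H a b : ℝ} (ha : 0 < a) (hb : 0 < b) :
    arctan (H / b) - arctan (H / a) = arctan (H * (a - b) / (a * b + H ^ 2)) := by
  have h : H / b * -(H / a) < 1 := by
    have : 0 ≤ H / b * (H / a) := by
      rw [div_mul_div_comm]
      exact div_nonneg (mul_self_nonneg H) (by positivity)
    linarith
  have hne : a * b + H ^ 2 ≠ 0 := by positivity
  rw [sub_eq_add_neg, ← arctan_neg, arctan_add h]
  congr 1
  have hden : 1 - H / b * -(H / a) = (a * b + H ^ 2) / (a * b) := by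
    field_simp
    ring
  rw [hden]
  field_simp
  ring

/-- The tangent-line bound for the convex function `u ↦ arctan (H / √u)`, with `u = a ^ 2`. -/
lemma arctan_div_sub_le_arctan_div {H a b : ℝ} (hH : 0 < H) (ha : 0 < a) (hb : 0 < b) :
    arctan (H / b) - H * (a ^ 2 - b ^ 2) / (2 * b * (H ^ 2 + b ^ 2)) ≤ arctan (H / a) := by
  rcases le_total b a with hab | hab
  · have hd : 0 ≤ a - b := sub_nonneg.mpr hab
    have hle := arctan_le_self_of_nonneg (y := H * (a - b) / (a * b + H ^ 2)) (by positivity)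
    rw [← arctan_div_sub_arctan_div ha hb] at hle
    have hbound : H * (a - b) / (a * b + H ^ 2) ≤
        H * (a ^ 2 - b ^ 2) / (2 * b * (H ^ 2 + b ^ 2)) := by
      have hden : 2 * b * (H ^ 2 + b ^ 2) ≤ (a + b) * (a * b + H ^ 2) := by
        have : 2 * b ≤ a + b := by linarith
        have : H ^ 2 + b ^ 2 ≤ a * b + H ^ 2 := by nlinarith
        gcongr
      rw [div_le_div_iff₀ (by positivity) (by positivity)]
      calc H * (a - b) * (2 * b * (H ^ 2 + b ^ 2))
          ≤ H * (a - b) * ((a + b) * (a * b + H ^ 2)) := by gcongr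
        _ = H * (a ^ 2 - b ^ 2) * (a * b + H ^ 2) := by ring
    linarith
  · have hd : 0 ≤ b - a := sub_nonneg.mpr hab
    have hle := div_one_add_sq_le_arctan (y := H * (b - a) / (b * a + H ^ 2)) (by positivity)
    rw [← arctan_div_sub_arctan_div hb ha] at hle
    have hval : H * (b - a) / (b * a + H ^ 2) / (1 + (H * (b - a) / (b * a + H ^ 2)) ^ 2) =
        H * (b - a) * (b * a + H ^ 2) / ((H ^ 2 + a ^ 2) * (H ^ 2 + b ^ 2)) := by
      have hsum : 1 + (H * (b - a) / (b * a + H ^ 2)) ^ 2 =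
          (H ^ 2 + a ^ 2) * (H ^ 2 + b ^ 2) / (b * a + H ^ 2) ^ 2 := by
        field_simp
        ring
      rw [hsum]
      field_simp
    have hbound : H * (b ^ 2 - a ^ 2) / (2 * b * (H ^ 2 + b ^ 2)) ≤
        H * (b - a) * (b * a + H ^ 2) / ((H ^ 2 + a ^ 2) * (H ^ 2 + b ^ 2)) := by
      have hnum : (a + b) * (H ^ 2 + a ^ 2) ≤ 2 * b * (b * a + H ^ 2) := by
        have : a + b ≤ 2 * b := by linarith
        have : H ^ 2 + a ^ 2 ≤ b * a + H ^ 2 := by nlinarith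
        gcongr
      rw [div_le_div_iff₀ (by positivity) (by positivity)]
      calc H * (b ^ 2 - a ^ 2) * ((H ^ 2 + a ^ 2) * (H ^ 2 + b ^ 2))
          = H * (b - a) * (H ^ 2 + b ^ 2) * ((a + b) * (H ^ 2 + a ^ 2)) := by ring
        _ ≤ H * (b - a) * (H ^ 2 + b ^ 2) * (2 * b * (b * a + H ^ 2)) := by gcongr
        _ = H * (b - a) * (b * a + H ^ 2) * (2 * b * (H ^ 2 + b ^ 2)) := by ring
    have hneg : H * (a ^ 2 - b ^ 2) / (2 * b * (H ^ 2 + b ^ 2)) =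
        -(H * (b ^ 2 - a ^ 2) / (2 * b * (H ^ 2 + b ^ 2))) := by ring
    linarith

/-- Theorem 2 (upper bound): `Y(q) ≤ Y^{up}(q)`, obtained by Taylor-expanding
`arctan (H/√u)` at `u₀ = ‖qʳ − g‖²`. -/
theorem stmt_6 (H A B : ℝ) (hH : 0 < H) (hA : 0 ≤ A) (hB : 0 ≤ B)
    (g q qr : EuclideanSpace ℝ (Fin 2)) (hq : q ≠ g) (hqr : qr ≠ g)
    (u₀ : ℝ) (hu₀ : u₀ = ‖qr - g‖ ^ 2) :
    1 + A * Real.exp (-B * ((180 / π) * Real.arctan (H / ‖q - g‖) - A)) ≤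
      1 + A * Real.exp (-B * ((180 / π) *
        (Real.arctan (H / Real.sqrt u₀) -
          H * (‖q - g‖ ^ 2 - u₀) / (2 * Real.sqrt u₀ * (H ^ 2 + u₀))) - A)) := by
  subst hu₀
  rw [sqrt_sq (norm_nonneg _)]
  have h := arctan_div_sub_le_arctan_div hH (norm_pos_iff.mpr (sub_ne_zero.mpr hq))
    (norm_pos_iff.mpr (sub_ne_zero.mpr hqr))
  rw [neg_mul, neg_mul]
  gcongr
end

section
/- Let H > 0, A ≥ 0, B ≥ 0, u₀ > 0 be real numbers and g a point of the Euclidean plane ℝ². Then the function q ↦ 1 + A · Real.exp ( −B · ( (180/π) · ( Real.arctan ( H / Real.sqrt u₀ ) − H · ( ‖q − g‖² − u₀ ) / ( 2 · Real.sqrt u₀ · (H² + u₀) ) ) − A ) ) is convex on all of ℝ². -/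
open Real

theorem ConvexOn.real_exp {E : Type*} [AddCommMonoid E] [Module ℝ E] {s : Set E} {f : E → ℝ}
    (hf : ConvexOn ℝ s f) : ConvexOn ℝ s (fun x => Real.exp (f x)) :=
  ⟨hf.1, fun _ hx _ hy _ _ ha hb hab =>
    (Real.exp_le_exp.2 (hf.2 hx hy ha hb hab)).trans
      (convexOn_exp.2 (Set.mem_univ _) (Set.mem_univ _) ha hb hab)⟩

theorem convexOn_norm_sub_sq {E : Type*} [SeminormedAddCommGroup E] [NormedSpace ℝ E] (g : E) :
    ConvexOn ℝ Set.univ (fun q : E => ‖q - g‖ ^ 2) := by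
  simpa only [dist_eq_norm] using!
    (convexOn_univ_dist g).pow (fun _ _ => dist_nonneg) 2

/-- Theorem 2 (convexity): the upper bound `Y^{up}` is a convex function of the
UAV position `q` on all of ℝ². -/
theorem stmt_7 (H A B u₀ : ℝ) (hH : 0 < H) (hA : 0 ≤ A) (hB : 0 ≤ B) (hu₀ : 0 < u₀)
    (g : EuclideanSpace ℝ (Fin 2)) :
    ConvexOn ℝ Set.univ (fun q : EuclideanSpace ℝ (Fin 2) =>
      1 + A * Real.exp (-B * ((180 / π) *
        (Real.arctan (H / Real.sqrt u₀) -
          H * (‖q - g‖ ^ 2 - u₀) / (2 * Real.sqrt u₀ * (H ^ 2 + u₀))) - A))) := by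
  set D := 2 * Real.sqrt u₀ * (H ^ 2 + u₀)
  have hk : 0 ≤ B * (180 / π) * (H / D) := by positivity
  have hexp := (((convexOn_norm_sub_sq g).smul hk).add_const
    (-B * ((180 / π) * (Real.arctan (H / Real.sqrt u₀) + H * u₀ / D) - A))).real_exp
  refine ((hexp.smul hA).add_const 1).congr fun q _ => ?_
  simp only [Pi.add_apply, smul_eq_mul]
  rw [add_comm (A * _)]
  congr 3
  ring
end

section
/- Fix K ≥ 1, positive real constants C1, C2, C3, nonnegative weights P_1, …, P_K, and σ² > 0. Then: (a) for any reals H_1, …, H_K and H_1^{up}, …, H_K^{up} with 0 ≤ H_i ≤ H_i^{up} for all i, one has − logb 2 ( Σ_{i=1}^{K} P_i·H_i + σ² ) ≥ − logb 2 ( Σ_{i=1}^{K} P_i·H_i^{up} + σ² ); and (b) the function (x, y) ↦ − logb 2 ( Σ_{i=1}^{K} P_i·( C1·C2/(x_i·y_i) + C3/x_i ) + σ² ) is concave on the set {(x, y) ∈ ℝ^K × ℝ^K : x_i > 0 and y_i > 0 for every i}. -/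
/-- Two-term weighted Hölder inequality, with weights `a + b = 1`. -/
theorem rpow_mul_rpow_add_le {a b u₁ u₂ v₁ v₂ : ℝ} (ha : 0 ≤ a) (hb : 0 ≤ b) (hab : a + b = 1)
    (hu₁ : 0 ≤ u₁) (hu₂ : 0 ≤ u₂) (hv₁ : 0 ≤ v₁) (hv₂ : 0 ≤ v₂) :
    u₁ ^ a * v₁ ^ b + u₂ ^ a * v₂ ^ b ≤ (u₁ + u₂) ^ a * (v₁ + v₂) ^ b := by
  rcases ha.eq_or_lt with rfl | ha'
  · obtain rfl : b = 1 := by linarith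
    simp
  rcases hb.eq_or_lt with rfl | hb'
  · obtain rfl : a = 1 := by linarith
    simp
  rcases (add_nonneg hu₁ hu₂).eq_or_lt with hU | hU
  · obtain rfl : u₁ = 0 := by linarith
    obtain rfl : u₂ = 0 := by linarith
    simp [Real.zero_rpow ha'.ne']
  rcases (add_nonneg hv₁ hv₂).eq_or_lt with hV | hV
  · obtain rfl : v₁ = 0 := by linarith
    obtain rfl : v₂ = 0 := by linarith
    simp [Real.zero_rpow hb'.ne']
  have h₁ := Real.geom_mean_le_arith_mean2_weighted ha hb (div_nonneg hu₁ hU.le)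
    (div_nonneg hv₁ hV.le) hab
  have h₂ := Real.geom_mean_le_arith_mean2_weighted ha hb (div_nonneg hu₂ hU.le)
    (div_nonneg hv₂ hV.le) hab
  rw [Real.div_rpow hu₁ hU.le, Real.div_rpow hv₁ hV.le, div_mul_div_comm] at h₁
  rw [Real.div_rpow hu₂ hU.le, Real.div_rpow hv₂ hV.le, div_mul_div_comm] at h₂
  have hW : 0 < (u₁ + u₂) ^ a * (v₁ + v₂) ^ b :=
    mul_pos (Real.rpow_pos_of_pos hU a) (Real.rpow_pos_of_pos hV b)
  have hsum : a * (u₁ / (u₁ + u₂)) + b * (v₁ / (v₁ + v₂)) +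
      (a * (u₂ / (u₁ + u₂)) + b * (v₂ / (v₁ + v₂))) = 1 := by
    rw [← hab]
    field_simp
    ring
  have h := add_le_add h₁ h₂
  rwa [hsum, ← add_div, div_le_one hW] at h

/-- A nonnegative function on a convex set which is log-convex, in multiplicative form. -/
structure LogConvexOn {E : Type*} [AddCommGroup E] [Module ℝ E] (s : Set E) (f : E → ℝ) :
    Prop where
  convex : Convex ℝ s
  nonneg : ∀ x ∈ s, 0 ≤ f x
  le : ∀ x ∈ s, ∀ y ∈ s, ∀ a b : ℝ, 0 ≤ a → 0 ≤ b → a + b = 1 →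
    f (a • x + b • y) ≤ f x ^ a * f y ^ b

namespace LogConvexOn

variable {E : Type*} [AddCommGroup E] [Module ℝ E] {s : Set E} {f g : E → ℝ}

theorem const (hs : Convex ℝ s) {c : ℝ} (hc : 0 ≤ c) : LogConvexOn s fun _ => c where
  convex := hs
  nonneg _ _ := hc
  le _ _ _ _ a b ha hb hab := by
    rw [← Real.rpow_add_of_nonneg hc ha hb, hab, Real.rpow_one]

theorem add (hf : LogConvexOn s f) (hg : LogConvexOn s g) :
    LogConvexOn s fun x => f x + g x where
  convex := hf.convex
  nonneg x hx := add_nonneg (hf.nonneg x hx) (hg.nonneg x hx)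
  le x hx y hy a b ha hb hab :=
    (add_le_add (hf.le x hx y hy a b ha hb hab) (hg.le x hx y hy a b ha hb hab)).trans
      (rpow_mul_rpow_add_le ha hb hab (hf.nonneg x hx) (hg.nonneg x hx) (hf.nonneg y hy)
        (hg.nonneg y hy))

theorem mul (hf : LogConvexOn s f) (hg : LogConvexOn s g) :
    LogConvexOn s fun x => f x * g x where
  convex := hf.convex
  nonneg x hx := mul_nonneg (hf.nonneg x hx) (hg.nonneg x hx)
  le x hx y hy a b ha hb hab := by
    have hxy := hf.convex hx hy ha hb hab
    have h := mul_le_mul (hf.le x hx y hy a b ha hb hab) (hg.le x hx y hy a b ha hb hab)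
      (hg.nonneg _ hxy) ((hf.nonneg _ hxy).trans (hf.le x hx y hy a b ha hb hab))
    rwa [mul_mul_mul_comm, ← Real.mul_rpow (hf.nonneg x hx) (hg.nonneg x hx),
      ← Real.mul_rpow (hf.nonneg y hy) (hg.nonneg y hy)] at h

theorem sum {ι : Type*} (t : Finset ι) {F : ι → E → ℝ} (hs : Convex ℝ s)
    (hF : ∀ i ∈ t, LogConvexOn s (F i)) : LogConvexOn s fun x => ∑ i ∈ t, F i x := by
  classical
  induction t using Finset.induction_on with
  | empty => simpa using const hs le_rfl
  | insert i t hi ih =>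
    simp only [Finset.sum_insert hi]
    exact (hF i (Finset.mem_insert_self i t)).add
      (ih fun j hj => hF j (Finset.mem_insert_of_mem hj))

theorem inv_linearMap (hs : Convex ℝ s) (l : E →ₗ[ℝ] ℝ) (hl : ∀ x ∈ s, 0 < l x) :
    LogConvexOn s fun x => (l x)⁻¹ where
  convex := hs
  nonneg x hx := (inv_pos.2 (hl x hx)).le
  le x hx y hy a b ha hb hab := by
    have hx' := hl x hx
    have hy' := hl y hy
    rw [Real.inv_rpow hx'.le, Real.inv_rpow hy'.le, ← mul_inv, map_add, map_smul, map_smul]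
    exact inv_anti₀ (mul_pos (Real.rpow_pos_of_pos hx' a) (Real.rpow_pos_of_pos hy' b))
      (Real.geom_mean_le_arith_mean2_weighted ha hb hx'.le hy'.le hab)

theorem concaveOn_neg_logb (hf : LogConvexOn s f) (hpos : ∀ x ∈ s, 0 < f x) {c : ℝ}
    (hc : 1 < c) : ConcaveOn ℝ s fun x => -Real.logb c (f x) := by
  refine ⟨hf.convex, fun x hx y hy a b ha hb hab => ?_⟩
  have hx' := hpos x hx
  have hy' := hpos y hy
  have h := Real.logb_le_logb_of_le hc (hpos _ (hf.convex hx hy ha hb hab))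
    (hf.le x hx y hy a b ha hb hab)
  rw [Real.logb_mul (Real.rpow_pos_of_pos hx' a).ne' (Real.rpow_pos_of_pos hy' b).ne',
    Real.logb_rpow_eq_mul_logb_of_pos hx', Real.logb_rpow_eq_mul_logb_of_pos hy'] at h
  simp only [smul_eq_mul]
  linarith

end LogConvexOn

theorem convex_pos_prod_pos (ι : Type*) :
    Convex ℝ {p : (ι → ℝ) × (ι → ℝ) | (∀ i, 0 < p.1 i) ∧ (∀ i, 0 < p.2 i)} := by
  intro p hp q hq a b ha hb hab
  exact ⟨fun i => convex_Ioi (0 : ℝ) (hp.1 i) (hq.1 i) ha hb hab,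
    fun i => convex_Ioi (0 : ℝ) (hp.2 i) (hq.2 i) ha hb hab⟩

/-- Theorem 3: (a) replacing channel gains by upper bounds lowers
`−log₂(Σ P_i H_i + σ²)`; (b) `(x,y) ↦ −log₂(Σ P_i (C1C2/(x_i y_i)+C3/x_i)+σ²)`
is concave on the positive orthant. -/
theorem stmt_9 (K : ℕ) (hK : 1 ≤ K) (C1 C2 C3 : ℝ) (hC1 : 0 < C1) (hC2 : 0 < C2)
    (hC3 : 0 < C3) (P : Fin K → ℝ) (hP : ∀ i, 0 ≤ P i) (σ2 : ℝ) (hσ : 0 < σ2) :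
    (∀ H Hup : Fin K → ℝ, (∀ i, 0 ≤ H i) → (∀ i, H i ≤ Hup i) →
      -Real.logb 2 (∑ i, P i * H i + σ2) ≥ -Real.logb 2 (∑ i, P i * Hup i + σ2)) ∧
    ConcaveOn ℝ
      {p : (Fin K → ℝ) × (Fin K → ℝ) | (∀ i, 0 < p.1 i) ∧ (∀ i, 0 < p.2 i)}
      (fun p : (Fin K → ℝ) × (Fin K → ℝ) =>
        -Real.logb 2 (∑ i, P i * (C1 * C2 / (p.1 i * p.2 i) + C3 / p.1 i) + σ2)) := by
  refine ⟨fun H Hup hH hle => ?_, ?_⟩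
  · have hsum : 0 ≤ ∑ i, P i * H i := Finset.sum_nonneg fun i _ => mul_nonneg (hP i) (hH i)
    refine neg_le_neg (Real.logb_le_logb_of_le one_lt_two (by linarith) ?_)
    gcongr with i
    · exact hP i
    · exact hle i
  · have hs := convex_pos_prod_pos (Fin K)
    set s := {p : (Fin K → ℝ) × (Fin K → ℝ) | (∀ i, 0 < p.1 i) ∧ (∀ i, 0 < p.2 i)}
    have hx (i : Fin K) : LogConvexOn s fun p => (p.1 i)⁻¹ :=
      .inv_linearMap hs (LinearMap.proj i ∘ₗ LinearMap.fst ℝ _ _) fun p hp => hp.1 i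
    have hy (i : Fin K) : LogConvexOn s fun p => (p.2 i)⁻¹ :=
      .inv_linearMap hs (LinearMap.proj i ∘ₗ LinearMap.snd ℝ _ _) fun p hp => hp.2 i
    have hgain (i : Fin K) :
        LogConvexOn s fun p => P i * (C1 * C2 / (p.1 i * p.2 i) + C3 / p.1 i) := by
      simp only [div_eq_mul_inv, mul_inv]
      exact (LogConvexOn.const hs (hP i)).mul
        (((LogConvexOn.const hs (mul_pos hC1 hC2).le).mul ((hx i).mul (hy i))).add
          ((LogConvexOn.const hs hC3.le).mul (hx i)))
    have hsum := LogConvexOn.sum Finset.univ hs fun i _ => hgain i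
    exact (hsum.add (.const hs hσ.le)).concaveOn_neg_logb
      (fun p hp => add_pos_of_nonneg_of_pos (hsum.nonneg p hp) hσ) one_lt_two
end
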